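/- Let Δ0 be an MCS containing K_x y = T_y, K_y x = T_x, x ≡ c_x, y ≡ c_y, and let M^{Δ0} be the induced canonical model. For {z,z'} = {x,y} and any Δ ∈ Σ of M^{Δ0}, if ¬K_z z' ∈ Δ, then there is Δ' ∈ Σ such that Δ' ∼_z Δ and, for some c ∈ Cons, c≡z' ∈ Δ and ¬c≡z' ∈ Δ'. -/

import Mathlib

/-! Core definitions for the Epistemic Logic of Cops and Robbers (ELCR). -/

/-- The two players/variables. -/
inductive Var : Type
  | x | y
  deriving DecidableEq

/-- The other variable. -/
def Var.other : Var → Var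
  | .x => .y
  | .y => .x

/-- Terms: constants or variables. -/
inductive Term (Cons : Type) : Type
  | const (c : Cons)
  | var (v : Var)
  deriving DecidableEq

/-- Formulas of the full language `L` (with movement modalities). -/
inductive Form (Pred Cons : Type) : Type
  | pred (P : Pred) (args : List (Term Cons))
  | rel (t₁ t₂ : Term Cons)
  | eq (t₁ t₂ : Term Cons)
  | neg (φ : Form Pred Cons)
  | and (φ ψ : Form Pred Cons)
  | Kt (z : Var) (t : Term Cons)
  | K (z : Var) (φ : Form Pred Cons)
  | box (z : Var) (φ : Form Pred Cons)

namespace Form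

variable {Pred Cons : Type}

def imp (φ ψ : Form Pred Cons) : Form Pred Cons := .neg (.and φ (.neg ψ))
def or (φ ψ : Form Pred Cons) : Form Pred Cons := .neg (.and (.neg φ) (.neg ψ))
def iffF (φ ψ : Form Pred Cons) : Form Pred Cons := .and (imp φ ψ) (imp ψ φ)
def falseF : Form Pred Cons := .neg (.eq (.var .x) (.var .x))
def trueF : Form Pred Cons := .neg falseF
/-- `⟨K_z⟩φ := ¬K_z¬φ`. -/
def diaK (z : Var) (φ : Form Pred Cons) : Form Pred Cons := .neg (.K z (.neg φ))

def bigAnd : List (Form Pred Cons) → Form Pred Cons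
  | [] => trueF
  | φ :: l => .and φ (bigAnd l)

def bigOr : List (Form Pred Cons) → Form Pred Cons
  | [] => falseF
  | φ :: l => or φ (bigOr l)

/-- Membership in the Boolean base language `L_B`. -/
def isBase : Form Pred Cons → Prop
  | .pred _ _ => True
  | .rel _ _ => True
  | .eq _ _ => True
  | .neg φ => isBase φ
  | .and φ ψ => isBase φ ∧ isBase ψ
  | .Kt _ _ => False
  | .K _ _ => False
  | .box _ _ => False

/-- Membership in `L_BD` (Booleans plus movement modalities). -/
def isBD : Form Pred Cons → Prop
  | .pred _ _ => True
  | .rel _ _ => True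
  | .eq _ _ => True
  | .neg φ => isBD φ
  | .and φ ψ => isBD φ ∧ isBD ψ
  | .Kt _ _ => False
  | .K _ _ => False
  | .box _ φ => isBD φ

/-- Membership in the full language `L`. -/
def isL : Form Pred Cons → Prop
  | .pred _ _ => True
  | .rel _ _ => True
  | .eq _ _ => True
  | .neg φ => isL φ
  | .and φ ψ => isL φ ∧ isL ψ
  | .Kt _ _ => True
  | .K _ ψ => isBD ψ
  | .box _ φ => isL φ

/-- Membership in the static fragment `L⁻`: no movement modalities, and the
knowledge operator `K_z` is applied to `L_B`-formulas only. -/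
def isStatic : Form Pred Cons → Prop
  | .pred _ _ => True
  | .rel _ _ => True
  | .eq _ _ => True
  | .neg φ => isStatic φ
  | .and φ ψ => isStatic φ ∧ isStatic ψ
  | .Kt _ _ => True
  | .K _ φ => isBase φ
  | .box _ _ => False

/-- The variable `z` occurs in the formula. -/
def occurs (z : Var) : Form Pred Cons → Prop
  | .pred _ args => Term.var z ∈ args
  | .rel t₁ t₂ => t₁ = Term.var z ∨ t₂ = Term.var z
  | .eq t₁ t₂ => t₁ = Term.var z ∨ t₂ = Term.var z
  | .neg φ => occurs z φ
  | .and φ ψ => occurs z φ ∨ occurs z ψ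
  | .Kt w t => w = z ∨ t = Term.var z
  | .K w φ => w = z ∨ occurs z φ
  | .box w φ => w = z ∨ occurs z φ

/-- The list of terms occurring in a formula. -/
def termList : Form Pred Cons → List (Term Cons)
  | .pred _ args => args
  | .rel t₁ t₂ => [t₁, t₂]
  | .eq t₁ t₂ => [t₁, t₂]
  | .neg φ => termList φ
  | .and φ ψ => termList φ ++ termList ψ
  | .Kt _ t => [t]
  | .K _ φ => termList φ
  | .box _ φ => termList φ

end Form

/-- Substituting the constant `c` for the variable `z` in a term. -/
def Term.substC {Cons : Type} (c : Cons) (z : Var) : Term Cons → Term Cons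
  | .var v => if v = z then .const c else .var v
  | .const c' => .const c'

/-- `φ.substC c z` is `φ[c/z]`. -/
def Form.substC {Pred Cons : Type} (c : Cons) (z : Var) : Form Pred Cons → Form Pred Cons
  | .pred P args => .pred P (args.map (Term.substC c z))
  | .rel t₁ t₂ => .rel (t₁.substC c z) (t₂.substC c z)
  | .eq t₁ t₂ => .eq (t₁.substC c z) (t₂.substC c z)
  | .neg φ => .neg (φ.substC c z)
  | .and φ ψ => .and (φ.substC c z) (ψ.substC c z)
  | .Kt w t => .Kt w (t.substC c z)
  | .K w φ => .K w (φ.substC c z)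
  | .box w φ => .box w (φ.substC c z)

/-- Replacing the term `t₂` by the term `t₁`. -/
def Term.repl {Cons : Type} [DecidableEq Cons] (t₁ t₂ t : Term Cons) : Term Cons :=
  if t = t₂ then t₁ else t

/-- `φ.replace t₁ t₂` is `φ[t₁/t₂]`: the result of replacing `t₂` in `φ` with `t₁`. -/
def Form.replace {Pred Cons : Type} [DecidableEq Cons] (t₁ t₂ : Term Cons) :
    Form Pred Cons → Form Pred Cons
  | .pred P args => .pred P (args.map (Term.repl t₁ t₂))
  | .rel s₁ s₂ => .rel (Term.repl t₁ t₂ s₁) (Term.repl t₁ t₂ s₂)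
  | .eq s₁ s₂ => .eq (Term.repl t₁ t₂ s₁) (Term.repl t₁ t₂ s₂)
  | .neg φ => .neg (φ.replace t₁ t₂)
  | .and φ ψ => .and (φ.replace t₁ t₂) (ψ.replace t₁ t₂)
  | .Kt w t => .Kt w (Term.repl t₁ t₂ t)
  | .K w φ => .K w (φ.replace t₁ t₂)
  | .box w φ => .box w (φ.replace t₁ t₂)

/-- The list of all terms (constants and variables), for finite `Cons`. -/
noncomputable def allTerms (Cons : Type) [Fintype Cons] : List (Term Cons) :=
  (Finset.univ : Finset Cons).toList.map Term.const ++ [Term.var .x, Term.var .y]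

/-- The syntactic distance formulas `D^n t₁ t₂`. -/
noncomputable def distForm (Pred : Type) {Cons : Type} [Fintype Cons] :
    ℕ → Term Cons → Term Cons → Form Pred Cons
  | 0, t₁, t₂ => .eq t₁ t₂
  | n + 1, t₁, t₂ =>
      Form.or (distForm Pred n t₁ t₂)
        (Form.bigOr ((allTerms Cons).map fun t =>
          Form.and (distForm Pred n t₁ t) (Form.or (.rel t t₂) (.rel t₂ t))))

/-- `K_z z' = T`: the set `T` consists of the possible positions of `z'` considered by `z`. -/
noncomputable def KzEqSet {Pred Cons : Type} [Fintype Cons] [DecidableEq Cons]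
    (z z' : Var) (T : Finset Cons) : Form Pred Cons :=
  Form.bigAnd
    ((T.toList.map fun c => Form.diaK z (.eq (.var z') (.const c))) ++
      (Tᶜ.toList.map fun c => Form.K z (.neg (.eq (.var z') (.const c)))))

/-- `Rz = T`: `T` is exactly the set of (names of) R-successors of `z`. -/
noncomputable def RzEqSet {Pred Cons : Type} [Fintype Cons] [DecidableEq Cons]
    (z : Var) (T : Finset Cons) : Form Pred Cons :=
  Form.bigAnd
    ((T.toList.map fun c => Form.rel (.var z) (.const c)) ++
      (Tᶜ.toList.map fun c => Form.neg (Form.rel (.var z) (.const c))))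

/-- The list of all subsets of `Cons`. -/
noncomputable def powList (Cons : Type) [Fintype Cons] [DecidableEq Cons] : List (Finset Cons) :=
  (Finset.univ : Finset Cons).powerset.toList

/-! ### Semantics -/

/-- An interpretation of the vocabulary over a domain `D`. -/
structure Interp (Pred Cons D : Type) where
  pred : Pred → List D → Prop
  rel : D → D → Prop
  const : Cons → D

/-- Assignments (situations): positions of the two players. -/
abbrev Assign (D : Type) := Var → D

/-- The value of a term at an interpretation and a situation. -/
def Term.val {Pred Cons D : Type} (I : Interp Pred Cons D) (σ : Assign D) :
    Term Cons → D
  | .const c => I.const c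
  | .var v => σ v

/-- `Dball I m s` is `D^m(s)`: points reachable from `s` in at most `m` steps
along `I.rel` or its converse. -/
def Dball {Pred Cons D : Type} (I : Interp Pred Cons D) : ℕ → D → Set D
  | 0, s => {s}
  | m + 1, s => Dball I m s ∪ {t | ∃ u ∈ Dball I m s, I.rel u t ∨ I.rel t u}

/-- `R^z σ σ'`: player `z` moves along an arrow, the other player stays put. -/
def Rstep {Pred Cons D : Type} (I : Interp Pred Cons D) (z : Var) (σ σ' : Assign D) : Prop :=
  I.rel (σ z) (σ' z) ∧ σ z.other = σ' z.other

/-- Indistinguishability data: a relation on assignments for each player. -/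
abbrev SimRel (D : Type) := Var → Assign D → Assign D → Prop

/-- `Σ|σ`: the situations related to `σ` by some player's indistinguishability. -/
def restrict {D : Type} (Sit : Set (Assign D)) (sim : SimRel D) (σ : Assign D) :
    Set (Assign D) :=
  {σ' ∈ Sit | ∃ z, sim z σ σ'}

/-- The updated set of situations after player `z` moves from `σ₁` to `σ₂`. -/
def updSit {Pred Cons D : Type} (k : ℕ) (I : Interp Pred Cons D)
    (Sit : Set (Assign D)) (sim : SimRel D) (z : Var) (σ₁ σ₂ : Assign D) :
    Set (Assign D) :=
  {σ' | (σ₂ Var.x ∈ Dball I k (σ₂ Var.y) ∧ σ' = σ₂) ∨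
        (σ₂ Var.x ∉ Dball I k (σ₂ Var.y) ∧
          (∃ σ ∈ restrict Sit sim σ₁, Rstep I z σ σ') ∧
          σ' Var.x ∉ Dball I k (σ' Var.y))}

/-- The updated indistinguishability relations: `σ₁ ∼'_z σ₂` iff `σ₁ z = σ₂ z`. -/
def updSim (D : Type) : SimRel D := fun z σ₁ σ₂ => σ₁ z = σ₂ z

/-- Satisfaction for `ELCR` (with sight `k`). -/
def Sat {Pred Cons D : Type} (k : ℕ) (I : Interp Pred Cons D) :
    Set (Assign D) → SimRel D → Assign D → Form Pred Cons → Prop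
  | _, _, σ, .pred P args => I.pred P (args.map (Term.val I σ))
  | _, _, σ, .rel t₁ t₂ => I.rel (t₁.val I σ) (t₂.val I σ)
  | _, _, σ, .eq t₁ t₂ => t₁.val I σ = t₂.val I σ
  | Sit, sim, σ, .neg φ => ¬ Sat k I Sit sim σ φ
  | Sit, sim, σ, .and φ ψ => Sat k I Sit sim σ φ ∧ Sat k I Sit sim σ ψ
  | Sit, sim, σ, .Kt z t => ∀ σ' ∈ Sit, sim z σ' σ → t.val I σ = t.val I σ'
  | Sit, sim, σ, .K z φ => ∀ σ' ∈ Sit, sim z σ' σ → Sat k I Sit sim σ' φ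
  | Sit, sim, σ, .box z φ => ∀ σ₂, Rstep I z σ σ₂ →
      Sat k I (updSit k I Sit sim z σ σ₂) (updSim D) σ₂ φ

/-- The conditions making `(D, I, Σ, ∼)` a model: seriality of `I.rel`, every
point named by a constant, `Σ` nonempty, and each `∼_z` an equivalence relation on `Σ`. -/
structure IsModel {Pred Cons D : Type} (I : Interp Pred Cons D)
    (Sit : Set (Assign D)) (sim : SimRel D) : Prop where
  serial : ∀ s, ∃ t, I.rel s t
  const_surj : Function.Surjective I.const
  nonempty : Sit.Nonempty
  sim_mem : ∀ z σ σ', sim z σ σ' → σ ∈ Sit ∧ σ' ∈ Sit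
  sim_refl : ∀ z, ∀ σ ∈ Sit, sim z σ σ
  sim_symm : ∀ z σ σ', sim z σ σ' → sim z σ' σ
  sim_trans : ∀ z σ₁ σ₂ σ₃, sim z σ₁ σ₂ → sim z σ₂ σ₃ → sim z σ₁ σ₃

/-- The `k`-sight condition. -/
def KSight {Pred Cons D : Type} (k : ℕ) (I : Interp Pred Cons D)
    (Sit : Set (Assign D)) (sim : SimRel D) : Prop :=
  ∀ z σ σ', σ ∈ Sit → σ' ∈ Sit → sim z σ σ' →
    ∀ z', σ z' ∈ Dball I k (σ z) → σ z' = σ' z'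

/-- A nonempty conjunction `K_zα₁ ∧ ⋯ ∧ K_zαₙ ∧ ⟨K_z⟩β₁ ∧ ⋯ ∧ ⟨K_z⟩βₘ`. -/
def kConj {Pred Cons : Type} (z : Var) (αs βs : List (Form Pred Cons)) :
    Form Pred Cons :=
  Form.bigAnd (αs.map (Form.K z) ++ βs.map (Form.diaK z))
/-! ### The proof system ELCR⁻ -/

/-- Evaluation of a formula under a propositional valuation of its non-Boolean
components: used to define propositional tautologies. -/
def Form.evalProp {Pred Cons : Type} (v : Form Pred Cons → Prop) :
    Form Pred Cons → Prop
  | .neg φ => ¬ Form.evalProp v φ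
  | .and φ ψ => Form.evalProp v φ ∧ Form.evalProp v ψ
  | φ => v φ

/-- Propositional tautologies. -/
def Form.Tautology {Pred Cons : Type} (φ : Form Pred Cons) : Prop :=
  ∀ v : Form Pred Cons → Prop, Form.evalProp v φ

/-- The Hilbert-style proof system `ELCR⁻` for the static fragment, with sight `k`. -/
inductive Prov {Pred Cons : Type} [Fintype Cons] [DecidableEq Cons] (k : ℕ) :
    Form Pred Cons → Prop
  | taut {φ : Form Pred Cons} : φ.isStatic → φ.Tautology → Prov k φ
  | mp {φ ψ : Form Pred Cons} : Prov k (φ.imp ψ) → Prov k φ → Prov k ψ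
  | eqRefl (t : Term Cons) : Prov k (.eq t t)
  | eqSymm (t₁ t₂ : Term Cons) : Prov k ((Form.eq t₁ t₂).imp (.eq t₂ t₁))
  | eqTrans (t₁ t₂ t₃ : Term Cons) :
      Prov k (((Form.eq t₁ t₂).and (.eq t₂ t₃)).imp (.eq t₁ t₃))
  | eqSubst {α : Form Pred Cons} (t₁ t₂ : Term Cons) : α.isBase →
      Prov k ((Form.eq t₁ t₂).imp (α.iffF (α.replace t₁ t₂)))
  | seriality (c : Cons) :
      Prov k (Form.bigOr ((Finset.univ : Finset Cons).toList.map fun t =>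
        Form.rel (.const c) (.const t)))
  | atSomewhere (z : Var) :
      Prov k (Form.bigOr ((Finset.univ : Finset Cons).toList.map fun c =>
        Form.eq (.var z) (.const c)))
  | ksight (z : Var) (t : Term Cons) :
      Prov k ((distForm Pred k (.var z) t).imp (.Kt z t))
  | kAx {α β : Form Pred Cons} (z : Var) : α.isBase → β.isBase →
      Prov k ((Form.K z (α.imp β)).imp ((Form.K z α).imp (.K z β)))
  | tAx {α : Form Pred Cons} (z : Var) : α.isBase →
      Prov k ((Form.K z α).imp α)
  | kGround {α : Form Pred Cons} (z : Var) (T : Finset Cons) : α.isBase →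
      Prov k ((KzEqSet z z.other T).imp
        ((Form.K z α).iffF (Form.bigAnd (T.toList.map fun c => α.substC c z.other))))
  | kAdd {α : Form Pred Cons} (z : Var) (αs βs : List (Form Pred Cons)) :
      α.isBase → (∀ γ ∈ αs, γ.isBase) → (∀ γ ∈ βs, γ.isBase) →
      1 ≤ αs.length + βs.length →
      Prov k ((kConj z αs βs).imp α) → Prov k ((kConj z αs βs).imp (.K z α))
  | kElim {α β : Form Pred Cons} (z : Var) (αs βs : List (Form Pred Cons)) :
      α.isBase → β.isBase → (∀ γ ∈ αs, γ.isBase) → (∀ γ ∈ βs, γ.isBase) →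
      1 ≤ αs.length + βs.length →
      Prov k ((kConj z.other αs βs).imp ((Form.K z α).imp β)) →
      Prov k ((kConj z.other αs βs).imp (α.imp β))
  | deRe (z : Var) (t : Term Cons) (c : Cons) :
      Prov k ((Form.eq t (.const c)).imp
        ((Form.Kt z t).iffF (.K z (.eq t (.const c)))))
  | structK {α : Form Pred Cons} (z : Var) (T : Finset (Term Cons)) : α.isBase →
      (∀ t ∈ α.termList, t ∈ T) →
      Prov k (((Form.bigAnd (T.toList.map (Form.Kt z))).and α).imp (.K z α))

/-- A set of formulas is consistent if no finite conjunction from it proves `⊥`. -/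
def consistentS {Pred Cons : Type} [Fintype Cons] [DecidableEq Cons] (k : ℕ)
    (Γ : Set (Form Pred Cons)) : Prop :=
  ¬ ∃ l : List (Form Pred Cons), (∀ φ ∈ l, φ ∈ Γ) ∧
      Prov k ((Form.bigAnd l).imp Form.falseF)

/-- Maximally consistent sets of `L⁻`-formulas. -/
def MCS {Pred Cons : Type} [Fintype Cons] [DecidableEq Cons] (k : ℕ)
    (Δ : Set (Form Pred Cons)) : Prop :=
  consistentS k Δ ∧ (∀ φ ∈ Δ, Form.isStatic φ) ∧
    ∀ φ : Form Pred Cons, φ.isStatic → φ ∈ Δ ∨ Form.neg φ ∈ Δ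

/-- All terms of the formula are constants. -/
def isConsOnly {Pred Cons : Type} (φ : Form Pred Cons) : Prop :=
  ∀ t ∈ φ.termList, ∃ c : Cons, t = Term.const c

/-- `Δ₁ =^Cons Δ₂`: the two sets contain the same `L_B`-formulas whose terms are
all constants. -/
def consEq {Pred Cons : Type} (Δ₁ Δ₂ : Set (Form Pred Cons)) : Prop :=
  ∀ α : Form Pred Cons, α.isBase → isConsOnly α → (α ∈ Δ₁ ↔ α ∈ Δ₂)
/-! ### The canonical model -/

/-- The equivalence class of the constant `c` determined by `Δ₀`. -/
def eqClass {Pred Cons : Type} (Δ₀ : Set (Form Pred Cons)) (c : Cons) : Set Cons :=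
  {c' | Form.eq (Term.const c') (Term.const c) ∈ Δ₀}

/-- The canonical domain: equivalence classes of constants. -/
def CanD {Pred Cons : Type} (Δ₀ : Set (Form Pred Cons)) : Type :=
  {S : Set Cons // ∃ c, S = eqClass Δ₀ c}

/-- `[c]`, as an element of the canonical domain. -/
def canConst {Pred Cons : Type} (Δ₀ : Set (Form Pred Cons)) (c : Cons) : CanD Δ₀ :=
  ⟨eqClass Δ₀ c, c, rfl⟩

/-- The canonical interpretation. -/
def canI {Pred Cons : Type} (Δ₀ : Set (Form Pred Cons)) : Interp Pred Cons (CanD Δ₀) where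
  pred P ds := ∃ cs : List Cons, ds = cs.map (canConst Δ₀) ∧
    Form.pred P (cs.map Term.const) ∈ Δ₀
  rel d₁ d₂ := ∃ c₁ c₂, d₁ = canConst Δ₀ c₁ ∧ d₂ = canConst Δ₀ c₂ ∧
    Form.rel (Term.const c₁) (Term.const c₂) ∈ Δ₀
  const := canConst Δ₀

/-- `K_z Δ := {α : K_z α ∈ Δ}`. -/
def Kset {Pred Cons : Type} (z : Var) (Δ : Set (Form Pred Cons)) : Set (Form Pred Cons) :=
  {α | Form.K z α ∈ Δ}

/-- The canonical set of situations, as a collection of MCSs. -/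
def CanSit {Pred Cons : Type} [Fintype Cons] [DecidableEq Cons] (k : ℕ)
    (Δ₀ : Set (Form Pred Cons)) (Ty Tx : Finset Cons) (cx cy : Cons) :
    Set (Set (Form Pred Cons)) :=
  {Δ₀} ∪
  {Δ | MCS k Δ ∧ consEq Δ Δ₀ ∧ KzEqSet Var.x Var.y Ty ∈ Δ ∧
      Form.K Var.y (Form.eq (.var .x) (.const cx)) ∈ Δ ∧
      ∃ c ∈ Ty, Form.eq (.var .y) (.const c) ∈ Δ ∧
        Form.neg (Form.eq (.const c) (.const cy)) ∈ Δ} ∪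
  {Δ | MCS k Δ ∧ consEq Δ Δ₀ ∧ KzEqSet Var.y Var.x Tx ∈ Δ ∧
      Form.K Var.x (Form.eq (.var .y) (.const cy)) ∈ Δ ∧
      ∃ c ∈ Tx, Form.eq (.var .x) (.const c) ∈ Δ ∧
        Form.neg (Form.eq (.const c) (.const cx)) ∈ Δ}

/-- The assignment induced by an MCS `Δ`: `Δ(z) = [c]` whenever `z ≡ c ∈ Δ`. -/
noncomputable def canAsg {Pred Cons : Type} [Nonempty Cons]
    (Δ₀ Δ : Set (Form Pred Cons)) : Assign (CanD Δ₀) := fun z =>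
  canConst Δ₀ (open Classical in
    if h : ∃ c : Cons, Form.eq (Term.var z) (Term.const c) ∈ Δ then h.choose
    else Classical.arbitrary Cons)

/-- The canonical set of situations, as a set of assignments. -/
noncomputable def CanSitA {Pred Cons : Type} [Fintype Cons] [DecidableEq Cons] [Nonempty Cons]
    (k : ℕ) (Δ₀ : Set (Form Pred Cons)) (Ty Tx : Finset Cons) (cx cy : Cons) :
    Set (Assign (CanD Δ₀)) :=
  canAsg Δ₀ '' CanSit k Δ₀ Ty Tx cx cy

/-- The canonical indistinguishability relations: `Δ₁ ∼_z Δ₂` iff `K_z Δ₁ = K_z Δ₂`. -/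
def canSim {Pred Cons : Type} [Nonempty Cons] (Δ₀ : Set (Form Pred Cons))
    (S : Set (Set (Form Pred Cons))) : SimRel (CanD Δ₀) := fun z σ₁ σ₂ =>
  ∃ Δ₁ ∈ S, ∃ Δ₂ ∈ S, σ₁ = canAsg Δ₀ Δ₁ ∧ σ₂ = canAsg Δ₀ Δ₂ ∧ Kset z Δ₁ = Kset z Δ₂
theorem Var.other_other (z : Var) : z.other.other = z := by cases z <;> rfl

namespace Form

variable {Pred Cons : Type}

theorem isStatic_of_isBase {φ : Form Pred Cons} (h : φ.isBase) : φ.isStatic := by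
  induction φ with
  | neg φ ih => exact ih h
  | and φ ψ ih₁ ih₂ => exact ⟨ih₁ h.1, ih₂ h.2⟩
  | pred | rel | eq => trivial
  | Kt | K | box => exact h.elim

@[simp] theorem isStatic_neg {φ : Form Pred Cons} : (neg φ).isStatic ↔ φ.isStatic := Iff.rfl

@[simp] theorem isStatic_and {φ ψ : Form Pred Cons} :
    (and φ ψ).isStatic ↔ φ.isStatic ∧ ψ.isStatic := Iff.rfl

@[simp] theorem isStatic_imp {φ ψ : Form Pred Cons} :
    (imp φ ψ).isStatic ↔ φ.isStatic ∧ ψ.isStatic := Iff.rfl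

@[simp] theorem isStatic_or {φ ψ : Form Pred Cons} :
    (or φ ψ).isStatic ↔ φ.isStatic ∧ ψ.isStatic := Iff.rfl

@[simp] theorem isStatic_iffF {φ ψ : Form Pred Cons} :
    (iffF φ ψ).isStatic ↔ φ.isStatic ∧ ψ.isStatic := by
  simp only [iffF, isStatic_and, isStatic_imp]; tauto

@[simp] theorem isStatic_eq (s t : Term Cons) : (eq s t : Form Pred Cons).isStatic := trivial

@[simp] theorem isStatic_rel (s t : Term Cons) : (rel s t : Form Pred Cons).isStatic := trivial

@[simp] theorem isStatic_Kt (z : Var) (t : Term Cons) : (Kt z t : Form Pred Cons).isStatic :=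
  trivial

@[simp] theorem isStatic_K {z : Var} {φ : Form Pred Cons} : (K z φ).isStatic ↔ φ.isBase := Iff.rfl

@[simp] theorem isStatic_diaK {z : Var} {φ : Form Pred Cons} :
    (diaK z φ).isStatic ↔ φ.isBase := Iff.rfl

@[simp] theorem isStatic_falseF : (falseF : Form Pred Cons).isStatic := trivial

theorem isStatic_bigAnd {l : List (Form Pred Cons)} :
    (bigAnd l).isStatic ↔ ∀ φ ∈ l, φ.isStatic := by
  induction l with
  | nil => simp [bigAnd, trueF]
  | cons a l ih => simp [bigAnd, ih]

theorem isStatic_bigOr {l : List (Form Pred Cons)} :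
    (bigOr l).isStatic ↔ ∀ φ ∈ l, φ.isStatic := by
  induction l with
  | nil => simp [bigOr]
  | cons a l ih => simp [bigOr, ih]

theorem isStatic_distForm [Fintype Cons] (n : ℕ) (s t : Term Cons) :
    (distForm Pred n s t).isStatic := by
  induction n generalizing t with
  | zero => trivial
  | succ n ih => simp [distForm, isStatic_bigOr, ih]

theorem isStatic_KzEqSet [Fintype Cons] [DecidableEq Cons] (z z' : Var) (T : Finset Cons) :
    (KzEqSet z z' T : Form Pred Cons).isStatic := by
  rw [KzEqSet, isStatic_bigAnd]
  simp only [List.mem_append, List.mem_map]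
  rintro φ (⟨c, -, rfl⟩ | ⟨c, -, rfl⟩) <;> trivial

theorem isBase_substC {c : Cons} {z : Var} {φ : Form Pred Cons} (h : φ.isBase) :
    (φ.substC c z).isBase := by
  induction φ with
  | neg φ ih => exact ih h
  | and φ ψ ih₁ ih₂ => exact ⟨ih₁ h.1, ih₂ h.2⟩
  | pred | rel | eq => trivial
  | Kt | K | box => exact h.elim

theorem isBase_replace [DecidableEq Cons] {s t : Term Cons} {φ : Form Pred Cons}
    (h : φ.isBase) : (φ.replace s t).isBase := by
  induction φ with
  | neg φ ih => exact ih h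
  | and φ ψ ih₁ ih₂ => exact ⟨ih₁ h.1, ih₂ h.2⟩
  | pred | rel | eq => trivial
  | Kt | K | box => exact h.elim

theorem termList_substC (c : Cons) (z : Var) (φ : Form Pred Cons) :
    (φ.substC c z).termList = φ.termList.map (Term.substC c z) := by
  induction φ <;> simp_all [substC, termList]

theorem termList_replace [DecidableEq Cons] (s t : Term Cons) (φ : Form Pred Cons) :
    (φ.replace s t).termList = φ.termList.map (Term.repl s t) := by
  induction φ <;> simp_all [replace, termList]

theorem substC_of_isConsOnly (c : Cons) (z : Var) {φ : Form Pred Cons} (h : isConsOnly φ) :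
    φ.substC c z = φ := by
  have hterm : ∀ t : Term Cons, (∃ d, t = Term.const d) → t.substC c z = t := by
    rintro _ ⟨d, rfl⟩; rfl
  induction φ with
  | pred P args =>
    simp only [substC]
    congr 1
    simpa using List.map_congr_left (l := args) (g := id) fun t ht => hterm t (h t ht)
  | rel s t | eq s t =>
    simp only [substC]
    rw [hterm s (h s (by simp [termList])), hterm t (h t (by simp [termList]))]
  | neg φ ih | K _ φ ih | box _ φ ih => simp only [substC]; rw [ih h]
  | and φ ψ ih₁ ih₂ =>
    simp only [substC]
    rw [ih₁ fun t ht => h t (List.mem_append_left _ ht),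
      ih₂ fun t ht => h t (List.mem_append_right _ ht)]
  | Kt w t => simp only [substC]; rw [hterm t (h t (by simp [termList]))]

/-- Naming the two players by constants turns every formula into one about constants only. -/
theorem isConsOnly_replace_substC [DecidableEq Cons] (c d : Cons) (z : Var)
    (φ : Form Pred Cons) :
    isConsOnly ((φ.substC d z.other).replace (.const c) (.var z)) := by
  intro t ht
  rw [termList_replace, termList_substC, List.map_map, List.mem_map] at ht
  obtain ⟨s, -, rfl⟩ := ht
  cases s with
  | const e => exact ⟨e, by simp [Term.substC, Term.repl]⟩
  | var v =>
    cases v <;> cases z <;> simp [Term.substC, Term.repl, Var.other]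

@[simp] theorem evalProp_neg {v : Form Pred Cons → Prop} {φ : Form Pred Cons} :
    evalProp v (neg φ) ↔ ¬ evalProp v φ := Iff.rfl

@[simp] theorem evalProp_and {v : Form Pred Cons → Prop} {φ ψ : Form Pred Cons} :
    evalProp v (and φ ψ) ↔ evalProp v φ ∧ evalProp v ψ := Iff.rfl

@[simp] theorem evalProp_imp {v : Form Pred Cons → Prop} {φ ψ : Form Pred Cons} :
    evalProp v (imp φ ψ) ↔ (evalProp v φ → evalProp v ψ) := by
  simp [imp]

@[simp] theorem evalProp_or {v : Form Pred Cons → Prop} {φ ψ : Form Pred Cons} :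
    evalProp v (or φ ψ) ↔ (evalProp v φ ∨ evalProp v ψ) := by
  simp [or]; tauto

theorem evalProp_bigAnd {v : Form Pred Cons → Prop} {l : List (Form Pred Cons)} :
    evalProp v (bigAnd l) ↔ ¬ evalProp v falseF ∧ ∀ φ ∈ l, evalProp v φ := by
  induction l with
  | nil => simp [bigAnd, trueF]
  | cons a l ih => simp [bigAnd, ih]; tauto

theorem isStatic_kConj {z : Var} {αs βs : List (Form Pred Cons)} :
    (kConj z αs βs).isStatic ↔ (∀ α ∈ αs, α.isBase) ∧ ∀ β ∈ βs, β.isBase := by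
  simp [kConj, Form.isStatic_bigAnd, or_imp, forall_and]

/-- A finite set of knowledge literals of `Δ` is contained in a conjunction `kConj`. -/
theorem exists_kConj {Δ : Set (Form Pred Cons)} (z : Var) (l : List (Form Pred Cons))
    (hl : ∀ φ ∈ l, φ ∈ Δ ∧ ∃ α, φ = Form.K z α ∨ φ = Form.diaK z α) :
    ∃ αs βs : List (Form Pred Cons), (∀ α ∈ αs, Form.K z α ∈ Δ) ∧
      (∀ β ∈ βs, Form.diaK z β ∈ Δ) ∧
      ∀ φ ∈ l, φ ∈ αs.map (Form.K z) ++ βs.map (Form.diaK z) := by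
  induction l with
  | nil => exact ⟨[], [], by simp⟩
  | cons a l ih =>
    obtain ⟨αs, βs, h₁, h₂, h₃⟩ := ih fun φ hφ => hl φ (List.mem_cons_of_mem _ hφ)
    obtain ⟨ha, α, rfl | rfl⟩ := hl a List.mem_cons_self
    · refine ⟨α :: αs, βs, by simpa [ha] using h₁, h₂, ?_⟩
      simpa using fun φ hφ => Or.inr (by simpa using h₃ φ hφ)
    · refine ⟨αs, α :: βs, h₁, by simpa [ha] using h₂, ?_⟩
      simp only [List.mem_cons, forall_eq_or_imp, List.map_cons, List.mem_append]
      refine ⟨by simp, fun φ hφ => ?_⟩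
      have := h₃ φ hφ
      rw [List.mem_append] at this
      tauto

end Form

section Derivations

variable {Pred Cons : Type} [Fintype Cons] [DecidableEq Cons] {k : ℕ}

theorem Prov.isStatic {φ : Form Pred Cons} (h : Prov k φ) : φ.isStatic := by
  have base := @Form.isStatic_of_isBase Pred Cons
  induction h with
  | taut h => exact h
  | mp _ _ ih => exact (Form.isStatic_imp.1 ih).2
  | eqRefl | eqSymm | eqTrans | deRe => simp [Form.isBase]
  | eqSubst s t h => simp [base h, base (Form.isBase_replace h)]
  | seriality | atSomewhere => simp [Form.isStatic_bigOr]
  | ksight => simp [Form.isStatic_distForm]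
  | kAx _ ha hb => exact ⟨⟨ha, hb⟩, ha, hb⟩
  | tAx _ ha => exact ⟨ha, base ha⟩
  | kGround z T ha =>
    simp only [Form.isStatic_imp, Form.isStatic_iffF, Form.isStatic_KzEqSet, Form.isStatic_K, ha,
      true_and, Form.isStatic_bigAnd, List.mem_map]
    rintro _ ⟨c, -, rfl⟩
    exact base (Form.isBase_substC ha)
  | kAdd z αs βs h _ _ _ _ ih => exact ⟨ih.1, h⟩
  | kElim z αs βs ha hb _ _ _ _ ih => exact ⟨ih.1, base ha, base hb⟩
  | structK z T ha _ => simp [Form.isStatic_bigAnd, ha, base ha]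

theorem Prov.of_evalProp {φ ψ : Form Pred Cons} (h : Prov k φ) (hψ : ψ.isStatic)
    (H : ∀ v, Form.evalProp v φ → Form.evalProp v ψ) : Prov k ψ :=
  .mp (.taut (Form.isStatic_imp.2 ⟨h.isStatic, hψ⟩) fun v => Form.evalProp_imp.2 (H v)) h

theorem Prov.and_intro {φ ψ : Form Pred Cons} (h : Prov k φ) (h' : Prov k ψ) :
    Prov k (φ.and ψ) := by
  refine .mp (h.of_evalProp (ψ := ψ.imp (φ.and ψ)) ?_ ?_) h'
  · simp [h.isStatic, h'.isStatic]
  · intro v hv; simp [hv]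

theorem Prov.distForm_self (n : ℕ) (t : Term Cons) : Prov k (distForm Pred n t t) := by
  induction n with
  | zero => exact .eqRefl t
  | succ n ih =>
    refine ih.of_evalProp (Form.isStatic_distForm _ _ _) fun v hv => ?_
    rw [distForm, Form.evalProp_or]
    exact .inl hv

theorem not_consistentS_insert {Γ : Set (Form Pred Cons)} {φ : Form Pred Cons}
    (hΓ : ∀ ψ ∈ Γ, ψ.isStatic) (hφ : φ.isStatic) (h : ¬ consistentS k (insert φ Γ)) :
    ∃ l : List (Form Pred Cons), (∀ ψ ∈ l, ψ ∈ Γ) ∧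
      Prov k ((Form.bigAnd l).imp (φ.imp .falseF)) := by
  classical
  obtain ⟨l, hl, hp⟩ := not_not.1 h
  have hmem : ∀ ψ ∈ l.filter (· ≠ φ), ψ ∈ Γ := by
    intro ψ hψ
    simp only [ne_eq, decide_not, List.mem_filter, Bool.not_eq_true', decide_eq_false_iff_not] at hψ
    exact (hl ψ hψ.1).resolve_left hψ.2
  refine ⟨l.filter (· ≠ φ), hmem, hp.of_evalProp ?_ fun v hv => ?_⟩
  · simpa [hφ] using Form.isStatic_bigAnd.2 fun ψ hψ => hΓ ψ (hmem ψ hψ)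
  · rw [Form.evalProp_imp, Form.evalProp_bigAnd] at *
    rw [Form.evalProp_imp]
    intro h₁ h₂
    refine hv ⟨h₁.1, fun ψ hψ => ?_⟩
    by_cases hψφ : ψ = φ
    · exact hψφ ▸ h₂
    · exact h₁.2 ψ (by simp [hψ, hψφ])

/-- Lindenbaum's lemma. -/
theorem exists_MCS_superset {Γ : Set (Form Pred Cons)} (hΓ : ∀ φ ∈ Γ, φ.isStatic)
    (hc : consistentS k Γ) : ∃ Δ, Γ ⊆ Δ ∧ MCS k Δ := by
  obtain ⟨Δ, hsub, hmax⟩ := zorn_subset_nonempty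
    {Δ : Set (Form Pred Cons) | consistentS k Δ ∧ ∀ φ ∈ Δ, φ.isStatic}
    (fun C hC hchain hne => by
      refine ⟨⋃₀ C, ⟨?_, ?_⟩, fun s hs => Set.subset_sUnion_of_mem hs⟩
      · rintro ⟨l, hl, hp⟩
        have : ∃ s ∈ C, ∀ φ ∈ l, φ ∈ s := by
          clear hp
          induction l with
          | nil => exact ⟨_, hne.some_mem, by simp⟩
          | cons a l ih =>
            obtain ⟨s, hs, hsl⟩ := ih fun φ hφ => hl φ (List.mem_cons_of_mem _ hφ)
            obtain ⟨t, ht, hat⟩ := hl a List.mem_cons_self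
            rcases hchain.total hs ht with hst | hts
            · exact ⟨t, ht, by simpa [hat] using fun φ hφ => hst (hsl φ hφ)⟩
            · exact ⟨s, hs, by simpa [hts hat] using hsl⟩
        obtain ⟨s, hs, hsl⟩ := this
        exact (hC hs).1 ⟨l, hsl, hp⟩
      · rintro φ ⟨s, hs, hφ⟩
        exact (hC hs).2 φ hφ) Γ ⟨hc, hΓ⟩
  obtain ⟨⟨hcΔ, hsΔ⟩, hmax⟩ := hmax
  refine ⟨Δ, hsub, hcΔ, hsΔ, fun φ hφ => ?_⟩
  have key : ∀ ψ : Form Pred Cons, ψ.isStatic → ψ ∉ Δ →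
      ∃ l : List (Form Pred Cons), (∀ χ ∈ l, χ ∈ Δ) ∧
        Prov k ((Form.bigAnd l).imp (ψ.imp .falseF)) := by
    intro ψ hψ hn
    refine not_consistentS_insert hsΔ hψ fun hcon => hn ?_
    refine hmax ⟨hcon, ?_⟩ (Set.subset_insert ψ Δ) (Set.mem_insert ψ Δ)
    rintro χ (rfl | hχ)
    exacts [hψ, hsΔ χ hχ]
  by_contra! hn
  obtain ⟨l₁, hl₁, hp₁⟩ := key φ hφ hn.1
  obtain ⟨l₂, hl₂, hp₂⟩ := key φ.neg hφ hn.2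
  have hl : ∀ χ ∈ l₁ ++ l₂, χ ∈ Δ := fun χ hχ => (List.mem_append.1 hχ).elim (hl₁ χ) (hl₂ χ)
  refine hcΔ ⟨l₁ ++ l₂, hl, (hp₁.and_intro hp₂).of_evalProp ?_ fun v hv => ?_⟩
  · simpa using Form.isStatic_bigAnd.2 fun ψ hψ => hsΔ ψ (hl ψ hψ)
  · simp only [Form.evalProp_and, Form.evalProp_imp, Form.evalProp_bigAnd, List.mem_append,
      Form.evalProp_neg, or_imp, forall_and] at hv ⊢
    tauto

namespace MCS

variable {Δ Δ' : Set (Form Pred Cons)} {φ ψ : Form Pred Cons}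

theorem mem_of_imp (hM : MCS k Δ) {l : List (Form Pred Cons)} (hl : ∀ χ ∈ l, χ ∈ Δ)
    (hp : Prov k ((Form.bigAnd l).imp φ)) : φ ∈ Δ := by
  refine (hM.2.2 φ (Form.isStatic_imp.1 hp.isStatic).2).resolve_right fun hn => ?_
  have hl' : ∀ χ ∈ φ.neg :: l, χ ∈ Δ := by simpa [hn] using hl
  refine hM.1 ⟨φ.neg :: l, hl', hp.of_evalProp ?_ fun v hv => ?_⟩
  · simpa using Form.isStatic_bigAnd.2 fun ψ hψ => hM.2.1 ψ (hl' ψ hψ)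
  · simp only [Form.evalProp_imp, Form.evalProp_bigAnd, List.mem_cons, forall_eq_or_imp,
      Form.evalProp_neg] at hv ⊢
    tauto

theorem mem_of_prov (hM : MCS k Δ) (hp : Prov k φ) : φ ∈ Δ :=
  hM.mem_of_imp (l := []) (by simp) <| hp.of_evalProp
    (by simpa [Form.bigAnd, Form.trueF] using hp.isStatic) fun v hv => by simp [hv]

theorem mem_of_evalProp (hM : MCS k Δ) {l : List (Form Pred Cons)} (hl : ∀ χ ∈ l, χ ∈ Δ)
    (hφ : φ.isStatic) (H : ∀ v, (∀ χ ∈ l, Form.evalProp v χ) → Form.evalProp v φ) : φ ∈ Δ :=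
  hM.mem_of_imp hl <| .taut
    (Form.isStatic_imp.2 ⟨Form.isStatic_bigAnd.2 fun ψ hψ => hM.2.1 ψ (hl ψ hψ), hφ⟩)
    fun v => by
      rw [Form.evalProp_imp, Form.evalProp_bigAnd]
      exact fun h => H v h.2

theorem imp_mem (hM : MCS k Δ) (h : φ.imp ψ ∈ Δ) (hφ : φ ∈ Δ) : ψ ∈ Δ :=
  hM.mem_of_evalProp (l := [φ.imp ψ, φ]) (by simp [h, hφ])
    (Form.isStatic_imp.1 (hM.2.1 _ h)).2 fun v hv => by simp_all

theorem mp (hM : MCS k Δ) (h : Prov k (φ.imp ψ)) (hφ : φ ∈ Δ) : ψ ∈ Δ :=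
  hM.imp_mem (hM.mem_of_prov h) hφ

theorem and_mem_iff (hM : MCS k Δ) : φ.and ψ ∈ Δ ↔ φ ∈ Δ ∧ ψ ∈ Δ := by
  refine ⟨fun h => ?_, fun h => ?_⟩
  · have hs := Form.isStatic_and.1 (hM.2.1 _ h)
    exact ⟨hM.mem_of_evalProp (l := [φ.and ψ]) (by simpa) hs.1 fun v hv => by simp_all,
      hM.mem_of_evalProp (l := [φ.and ψ]) (by simpa) hs.2 fun v hv => by simp_all⟩
  · exact hM.mem_of_evalProp (l := [φ, ψ]) (by simp [h])
      ⟨hM.2.1 _ h.1, hM.2.1 _ h.2⟩ fun v hv => by simpa using hv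

theorem iffF_mem (hM : MCS k Δ) (h : φ.iffF ψ ∈ Δ) : φ ∈ Δ ↔ ψ ∈ Δ := by
  obtain ⟨h₁, h₂⟩ := hM.and_mem_iff.1 h
  exact ⟨hM.imp_mem h₁, hM.imp_mem h₂⟩

theorem not_mem_of_neg_mem (hM : MCS k Δ) (h : φ.neg ∈ Δ) : φ ∉ Δ := fun h' => by
  have hs : φ.isStatic := hM.2.1 _ h'
  refine hM.1 ⟨[φ, φ.neg], by simp [h, h'], .taut ?_ fun v => ?_⟩
  · simp [Form.isStatic_bigAnd, hs]
  · rw [Form.evalProp_imp, Form.evalProp_bigAnd]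
    rintro ⟨-, hv⟩
    simp at hv

theorem bigAnd_mem_iff (hM : MCS k Δ) {l : List (Form Pred Cons)} :
    Form.bigAnd l ∈ Δ ↔ ∀ φ ∈ l, φ ∈ Δ := by
  induction l with
  | nil =>
    simp only [Form.bigAnd, List.not_mem_nil, false_imp_iff, implies_true, iff_true]
    refine hM.mem_of_prov ((Prov.eqRefl (.var .x)).of_evalProp (by trivial) fun v hv => ?_)
    simpa [Form.trueF, Form.falseF] using hv
  | cons a l ih => rw [Form.bigAnd, hM.and_mem_iff, ih]; simp

theorem eq_symm_mem (hM : MCS k Δ) {s t : Term Cons} (h : Form.eq s t ∈ Δ) : Form.eq t s ∈ Δ :=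
  hM.mp (.eqSymm s t) h

theorem eq_trans_mem (hM : MCS k Δ) {s t u : Term Cons} (h : Form.eq s t ∈ Δ)
    (h' : Form.eq t u ∈ Δ) : Form.eq s u ∈ Δ :=
  hM.mp (.eqTrans s t u) (hM.and_mem_iff.2 ⟨h, h'⟩)

theorem K_mem_iff (hM : MCS k Δ) {z : Var} {T : Finset Cons} (hT : KzEqSet z z.other T ∈ Δ)
    {α : Form Pred Cons} (hα : α.isBase) :
    Form.K z α ∈ Δ ↔ ∀ c ∈ T, α.substC c z.other ∈ Δ := by
  rw [hM.iffF_mem (hM.mp (.kGround z T hα) hT), hM.bigAnd_mem_iff]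
  simp

theorem Kt_mem_iff (hM : MCS k Δ) (z : Var) {t : Term Cons} {c : Cons}
    (h : Form.eq t (.const c) ∈ Δ) :
    Form.Kt z t ∈ Δ ↔ Form.K z (.eq t (.const c)) ∈ Δ :=
  hM.iffF_mem (hM.mp (.deRe z t c) h)

theorem K_self_mem (hM : MCS k Δ) {z : Var} {c : Cons}
    (h : Form.eq (.var z) (.const c) ∈ Δ) : Form.K z (.eq (.var z) (.const c)) ∈ Δ :=
  (hM.Kt_mem_iff z h).1 (hM.mp (.ksight z (.var z)) (hM.mem_of_prov (.distForm_self k _)))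

theorem K_mem_of_isConsOnly (hM : MCS k Δ) {z : Var} {T : Finset Cons}
    (hT : KzEqSet z z.other T ∈ Δ) {α : Form Pred Cons} (hα : α.isBase) (hc : isConsOnly α)
    (h : α ∈ Δ) : Form.K z α ∈ Δ :=
  (hM.K_mem_iff hT hα).2 fun c _ => (Form.substC_of_isConsOnly c z.other hc).symm ▸ h

theorem replace_mem_iff (hM : MCS k Δ) {s t : Term Cons} (h : Form.eq s t ∈ Δ)
    {α : Form Pred Cons} (hα : α.isBase) : α ∈ Δ ↔ α.replace s t ∈ Δ :=
  hM.iffF_mem (hM.mp (.eqSubst s t hα) h)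

theorem consEq_of_forall (hM : MCS k Δ) (hM' : MCS k Δ')
    (h : ∀ α : Form Pred Cons, α.isBase → isConsOnly α → α ∈ Δ → α ∈ Δ') : consEq Δ Δ' := by
  refine fun α hα hc => ⟨h α hα hc, fun hαΔ' => ?_⟩
  exact (hM.2.2 α (Form.isStatic_of_isBase hα)).resolve_right fun hn =>
    hM'.not_mem_of_neg_mem (h α.neg hα hc hn) hαΔ'

/-- What `z` knows is determined by the facts about constants, the position of `z`, and the
positions of the other player that `z` considers possible. -/
theorem Kset_eq (hM : MCS k Δ) (hM' : MCS k Δ') (hΔ : consEq Δ Δ') {z : Var} {T : Finset Cons}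
    (hT : KzEqSet z z.other T ∈ Δ) (hT' : KzEqSet z z.other T ∈ Δ') {c : Cons}
    (hc : Form.eq (.var z) (.const c) ∈ Δ) (hc' : Form.eq (.var z) (.const c) ∈ Δ') :
    Kset z Δ = Kset z Δ' := by
  have key : ∀ α : Form Pred Cons, α.isBase → (Form.K z α ∈ Δ ↔ Form.K z α ∈ Δ') := by
    intro α hα
    rw [hM.K_mem_iff hT hα, hM'.K_mem_iff hT' hα]
    refine forall₂_congr fun d _ => ?_
    have hb := Form.isBase_substC (c := d) (z := z.other) hα
    rw [hM.replace_mem_iff (hM.eq_symm_mem hc) hb, hM'.replace_mem_iff (hM'.eq_symm_mem hc') hb]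
    exact hΔ _ (Form.isBase_replace hb) (Form.isConsOnly_replace_substC c d z α)
  ext α
  exact ⟨fun h => (key α (hM.2.1 _ h)).1 h, fun h => (key α (hM'.2.1 _ h)).2 h⟩

theorem exists_extension_eq (hM : MCS k Δ) {z : Var} {a c : Cons}
    (ha : Form.eq (.var z) (.const a) ∈ Δ)
    (hc : Form.diaK z (.eq (.var z.other) (.const c)) ∈ Δ) :
    ∃ Δ', MCS k Δ' ∧ (∀ α, Form.K z α ∈ Δ → Form.K z α ∈ Δ') ∧
      (∀ α, Form.diaK z α ∈ Δ → Form.diaK z α ∈ Δ') ∧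
      Form.eq (.var z.other) (.const c) ∈ Δ' ∧
      Form.K z.other (.eq (.var z) (.const a)) ∈ Δ' := by
  set G : Set (Form Pred Cons) := {φ | φ ∈ Δ ∧ ∃ α, φ = Form.K z α ∨ φ = Form.diaK z α}
  set e : Form Pred Cons := .eq (.var z.other) (.const c)
  set p : Form Pred Cons := .eq (.var z) (.const a)
  have hG : ∀ φ ∈ insert e G, φ.isStatic := by
    rintro φ (rfl | hφ)
    exacts [trivial, hM.2.1 _ hφ.1]
  have hcons : consistentS k (insert (Form.K z.other p) (insert e G)) := by
    by_contra hn
    obtain ⟨l, hl, hp⟩ := not_consistentS_insert hG (by trivial) hn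
    classical
    have hl' : ∀ φ ∈ l.filter (· ≠ e), φ ∈ G := by
      intro φ hφ
      simp only [ne_eq, decide_not, List.mem_filter, Bool.not_eq_true',
        decide_eq_false_iff_not] at hφ
      exact (hl φ hφ.1).resolve_left hφ.2
    obtain ⟨αs, βs, h₁, h₂, h₃⟩ := Form.exists_kConj z _ hl'
    have hpK : ∀ α ∈ p :: αs, Form.K z α ∈ Δ := List.forall_mem_cons.2 ⟨hM.K_self_mem ha, h₁⟩
    have hαs : ∀ α ∈ p :: αs, α.isBase := fun α hα => hM.2.1 _ (hpK α hα)
    have hβs : ∀ β ∈ βs, β.isBase := fun β hβ => hM.2.1 _ (h₂ β hβ)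
    have hst : (kConj z (p :: αs) βs).isStatic := Form.isStatic_kConj.2 ⟨hαs, hβs⟩
    have hlen : 1 ≤ (p :: αs).length + βs.length := by simp; omega
    have hp₁ : Prov k ((kConj z (p :: αs) βs).imp ((Form.K z.other p).imp e.neg)) := by
      refine hp.of_evalProp (by simp [hst, p, e, Form.isBase]) fun v hv => ?_
      simp only [kConj, Form.evalProp_imp, Form.evalProp_bigAnd, Form.evalProp_neg] at hv ⊢
      rintro ⟨hF, hK⟩ hKp he
      refine hF (hv ⟨hF, fun φ hφ => ?_⟩ hKp)
      by_cases hφe : φ = e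
      · exact hφe ▸ he
      · refine hK φ ?_
        have := h₃ φ (by simp [hφ, hφe])
        rw [List.map_cons, List.cons_append]
        exact List.mem_cons_of_mem _ this
    have hp₂ : Prov k ((kConj z (p :: αs) βs).imp (p.imp e.neg)) := by
      have h := Prov.kElim (k := k) (α := p) (β := e.neg) z.other (p :: αs) βs
        trivial trivial hαs hβs hlen
      rw [Var.other_other] at h
      exact h hp₁
    have hp₃ : Prov k ((kConj z (p :: αs) βs).imp e.neg) := by
      refine (hp₂.and_intro (Prov.tAx (α := p) z trivial)).of_evalProp
        (by simp [hst, e]) fun v hv => ?_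
      simp only [kConj, Form.evalProp_and, Form.evalProp_imp, Form.evalProp_bigAnd] at hv ⊢
      intro h
      exact hv.1 h (hv.2 (h.2 _ (by simp)))
    have hK : Form.K z e.neg ∈ Δ := by
      refine hM.mp (Prov.kAdd z (p :: αs) βs trivial hαs hβs hlen hp₃) ?_
      rw [kConj, hM.bigAnd_mem_iff]
      simp only [List.mem_append, List.mem_map]
      rintro φ (⟨α, hα, rfl⟩ | ⟨β, hβ, rfl⟩)
      exacts [hpK α hα, h₂ β hβ]
    exact hM.not_mem_of_neg_mem hc hK
  obtain ⟨Δ', hsub, hM'⟩ := exists_MCS_superset (by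
    rintro φ (rfl | hφ)
    exacts [trivial, hG φ hφ]) hcons
  exact ⟨Δ', hM', fun α h => hsub (.inr (.inr ⟨h, α, .inl rfl⟩)),
    fun α h => hsub (.inr (.inr ⟨h, α, .inr rfl⟩)), hsub (.inr (.inl rfl)), hsub (.inl rfl)⟩

theorem exists_extension (hM : MCS k Δ) {z : Var} {T : Finset Cons} {a b : Cons}
    (hT : KzEqSet z z.other T ∈ Δ) (ha : Form.eq (.var z) (.const a) ∈ Δ)
    (hb : Form.eq (.var z.other) (.const b) ∈ Δ)
    (hn : Form.neg (Form.Kt z (.var z.other)) ∈ Δ) :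
    ∃ Δ', (MCS k Δ' ∧ consEq Δ' Δ ∧ KzEqSet z z.other T ∈ Δ' ∧
      Form.K z.other (.eq (.var z) (.const a)) ∈ Δ' ∧
      ∃ c ∈ T, Form.eq (.var z.other) (.const c) ∈ Δ' ∧
        Form.neg (Form.eq (.const c) (.const b)) ∈ Δ') ∧
      Kset z Δ' = Kset z Δ ∧ Form.neg (Form.eq (.const b) (.var z.other)) ∈ Δ' := by
  have hnK := mt (hM.Kt_mem_iff z hb).2 (hM.not_mem_of_neg_mem hn)
  rw [hM.K_mem_iff (α := .eq (.var z.other) (.const b)) hT trivial] at hnK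
  push Not at hnK
  obtain ⟨c, hcT, hcb⟩ := hnK
  replace hcb : Form.eq (.const c) (.const b) ∉ Δ := by simpa [Form.substC, Term.substC] using hcb
  have hdia : Form.diaK z (.eq (.var z.other) (.const c)) ∈ Δ := by
    rw [KzEqSet, hM.bigAnd_mem_iff] at hT
    exact hT _ (List.mem_append_left _ (List.mem_map.2 ⟨c, by simpa using hcT, rfl⟩))
  obtain ⟨Δ', hM', hK, hD, he, hp⟩ := hM.exists_extension_eq ha hdia
  have hT' : KzEqSet z z.other T ∈ Δ' := by
    rw [KzEqSet, hM.bigAnd_mem_iff] at hT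
    rw [KzEqSet, hM'.bigAnd_mem_iff]
    intro φ hφ
    have h := hT φ hφ
    simp only [List.mem_append, List.mem_map] at hφ
    obtain ⟨d, -, rfl⟩ | ⟨d, -, rfl⟩ := hφ
    exacts [hD _ h, hK _ h]
  have hcons : consEq Δ Δ' := hM.consEq_of_forall hM' fun α hα hc h =>
    hM'.mp (.tAx z hα) (hK α (hM.K_mem_of_isConsOnly hT hα hc h))
  have hcb' : Form.eq (.const c) (.const b) ∉ Δ' :=
    mt (hcons (.eq (.const c) (.const b)) trivial (by simp [isConsOnly, Form.termList])).2 hcb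
  refine ⟨Δ', ⟨hM', fun α hα hc => (hcons α hα hc).symm, hT', hp, c, hcT, he,
    (hM'.2.2 (.eq (.const c) (.const b)) trivial).resolve_left hcb'⟩,
    (hM.Kset_eq hM' hcons hT hT' ha (hM'.mp (.tAx _ trivial) hp)).symm, ?_⟩
  exact (hM'.2.2 (.eq (.const b) (.var z.other)) trivial).resolve_left fun h =>
    hcb' (hM'.eq_symm_mem (hM'.eq_trans_mem h he))

/-- A situation of the canonical model that moves only the other player is `∼_z`-related to the
initial one, and disagrees with it about the position of that player. -/
theorem Kset_eq_of_alternative (hM : MCS k Δ) (hM' : MCS k Δ') {z : Var} {T : Finset Cons}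
    {a b : Cons} (hT : KzEqSet z z.other T ∈ Δ) (ha : Form.eq (.var z) (.const a) ∈ Δ)
    (hb : Form.eq (.var z.other) (.const b) ∈ Δ) (hcons : consEq Δ' Δ)
    (hT' : KzEqSet z z.other T ∈ Δ') (hp : Form.K z.other (.eq (.var z) (.const a)) ∈ Δ')
    {c : Cons} (hc : Form.eq (.var z.other) (.const c) ∈ Δ')
    (hcb : Form.neg (Form.eq (.const c) (.const b)) ∈ Δ') :
    Kset z Δ = Kset z Δ' ∧ ∃ c : Cons, Form.eq (.const c) (.var z.other) ∈ Δ' ∧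
      Form.neg (Form.eq (.const c) (.var z.other)) ∈ Δ := by
  refine ⟨(hM'.Kset_eq hM hcons hT' hT (hM'.mp (.tAx _ trivial) hp) ha).symm, c,
    hM'.eq_symm_mem hc, (hM.2.2 (.eq (.const c) (.var z.other)) trivial).resolve_left fun h =>
      hM'.not_mem_of_neg_mem hcb ?_⟩
  exact (hcons (.eq (.const c) (.const b)) trivial (by simp [isConsOnly, Form.termList])).2
    (hM.eq_trans_mem h hb)

theorem Kt_mem_of_K_eq (hM : MCS k Δ) {z : Var} {t : Term Cons} {c : Cons}
    (h : Form.K z (.eq t (.const c)) ∈ Δ) : Form.Kt z t ∈ Δ :=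
  (hM.Kt_mem_iff z (hM.mp (.tAx z trivial) h)).2 h

end MCS

end Derivations

/-- If `¬K_z z' ∈ Δ` for `Δ` in the canonical model, then some
`∼_z`-related `Δ'` disagrees with `Δ` about the position of `z'`. -/
theorem existence_lemma_Kt {Pred Cons : Type} [Fintype Cons] [DecidableEq Cons]
    [Nonempty Cons] (k : ℕ) (Δ₀ : Set (Form Pred Cons)) (Ty Tx : Finset Cons)
    (cx cy : Cons) (hM : MCS k Δ₀)
    (h₁ : KzEqSet Var.x Var.y Ty ∈ Δ₀) (h₂ : KzEqSet Var.y Var.x Tx ∈ Δ₀)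
    (h₃ : Form.eq (Term.var .x) (Term.const cx) ∈ Δ₀)
    (h₄ : Form.eq (Term.var .y) (Term.const cy) ∈ Δ₀) :
    ∀ z : Var, ∀ Δ ∈ CanSit k Δ₀ Ty Tx cx cy,
      Form.neg (Form.Kt z (Term.var z.other)) ∈ Δ →
      ∃ Δ' ∈ CanSit k Δ₀ Ty Tx cx cy, Kset z Δ' = Kset z Δ ∧
        ∃ c : Cons, Form.eq (Term.const c) (Term.var z.other) ∈ Δ ∧
          Form.neg (Form.eq (Term.const c) (Term.var z.other)) ∈ Δ' := by
  intro z Δ hΔ hn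
  cases z with
  | x =>
    rcases hΔ with (rfl | ⟨hM', hc, hT, hK, c, -, he, hne⟩) | ⟨hM', -, -, hK, -⟩
    · obtain ⟨Δ', hΔ', hKs, h⟩ := hM.exists_extension (z := .x) h₁ h₃ h₄ hn
      exact ⟨Δ', .inl (.inr hΔ'), hKs, cy, hM.eq_symm_mem h₄, h⟩
    · exact ⟨Δ₀, .inl (.inl rfl),
        hM.Kset_eq_of_alternative (z := .x) hM' h₁ h₃ h₄ hc hT hK he hne⟩
    · exact absurd (hM'.Kt_mem_of_K_eq hK) (hM'.not_mem_of_neg_mem hn)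
  | y =>
    rcases hΔ with (rfl | ⟨hM', -, -, hK, -⟩) | ⟨hM', hc, hT, hK, c, -, he, hne⟩
    · obtain ⟨Δ', hΔ', hKs, h⟩ := hM.exists_extension (z := .y) h₂ h₄ h₃ hn
      exact ⟨Δ', .inr hΔ', hKs, cx, hM.eq_symm_mem h₃, h⟩
    · exact absurd (hM'.Kt_mem_of_K_eq hK) (hM'.not_mem_of_neg_mem hn)
    · exact ⟨Δ₀, .inl (.inl rfl),
        hM.Kset_eq_of_alternative (z := .y) hM' h₂ h₄ h₃ hc hT hK he hne⟩
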